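/- Let d ≥ 2 and 2 ≤ k ≤ d be integers, let K ≥ 1, and let P ⊆ ℝ^d be a (k−1)-dimensional affine subspace with P ∩ S^{d−1} ≠ ∅. Then there is a constant C_d depending only on d such that N_{K^{−2}}(P) ∩ S^{d−1} ⊆ N_{C_d K^{−1}}(P ∩ S^{d−1}). -/

import Mathlib

open Metric

/-- For `d ≥ 2` there is a constant `C_d > 0`, depending only on `d`, such
that for every `2 ≤ k ≤ d`, every `K ≥ 1` and every `(k-1)`-dimensional affine subspace
`P ⊆ ℝ^d` meeting the unit sphere, the `K^{-2}`-neighbourhood of `P` intersected with the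
sphere is contained in the `C_d K^{-1}`-neighbourhood of `P ∩ S^{d-1}`. -/
theorem plane_sphere_neighbourhood (d : ℕ) (hd : 2 ≤ d) :
    ∃ C : ℝ, 0 < C ∧
      ∀ (k : ℕ), 2 ≤ k → k ≤ d →
      ∀ K : ℝ, 1 ≤ K →
      ∀ P : AffineSubspace ℝ (EuclideanSpace ℝ (Fin d)),
        Module.finrank ℝ P.direction = k - 1 →
        ((P : Set (EuclideanSpace ℝ (Fin d))) ∩ sphere 0 1).Nonempty →
        Metric.thickening (K ^ (-2 : ℝ)) (P : Set (EuclideanSpace ℝ (Fin d))) ∩ sphere 0 1 ⊆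
          Metric.thickening (C * K⁻¹) ((P : Set (EuclideanSpace ℝ (Fin d))) ∩ sphere 0 1) := by
  refine ⟨3, by norm_num, ?_⟩
  intro k hk hkd K hK P hdim hne x hx
  obtain ⟨hx1, hx2⟩ := hx
  obtain ⟨s, hsP, hs⟩ := hne
  rw [Metric.mem_thickening_iff] at hx1
  obtain ⟨p, hpP, hxp⟩ := hx1
  have hpP' : p ∈ P := hpP
  have hsP' : s ∈ P := hsP
  have hK0 : 0 < K := by linarith
  have hδ : K ^ (-2 : ℝ) = K⁻¹ ^ 2 := by
    rw [Real.rpow_neg hK0.le, inv_pow]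
    norm_num
  rw [hδ] at hxp
  set t := K⁻¹ with ht
  have ht0 : 0 < t := inv_pos.mpr hK0
  have ht1 : t ≤ 1 := inv_le_one_of_one_le₀ hK
  rw [mem_sphere_zero_iff_norm] at hx2 hs
  set V := P.direction with hV
  obtain ⟨a, haV, c, hc, hsac⟩ := V.exists_add_mem_mem_orthogonal s
  have horth : ∀ w ∈ V, ‖c + w‖ ^ 2 = ‖c‖ ^ 2 + ‖w‖ ^ 2 := by
    intro w hw
    have h := (Submodule.mem_orthogonal' V c).1 hc w hw
    rw [norm_add_sq_real, h]; ring
  have hcP : c ∈ P := by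
    have : (-a) +ᵥ s ∈ P := AffineSubspace.vadd_mem_of_mem_direction (V.neg_mem haV) hsP'
    rw [hsac] at this
    simpa using this
  have hvV : p - c ∈ V := AffineSubspace.vsub_mem_direction hpP' hcP
  set v := p - c with hv
  have hpv : p = c + v := by rw [hv]; abel
  have h1 : ‖c‖ ^ 2 + ‖a‖ ^ 2 = 1 := by
    rw [← horth a haV, add_comm c a, ← hsac, hs]; norm_num
  have h2 : ‖p‖ ^ 2 = ‖c‖ ^ 2 + ‖v‖ ^ 2 := by rw [← horth v hvV, ← hpv]
  -- a unit vector in the direction of v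
  obtain ⟨u, huV, hu1, hvu⟩ : ∃ u ∈ V, ‖u‖ = 1 ∧ v = ‖v‖ • u := by
    by_cases h0 : v = 0
    · have : Nontrivial V := Module.nontrivial_of_finrank_pos (R := ℝ) (by omega)
      obtain ⟨u, hu⟩ := exists_norm_eq V (zero_le_one (α := ℝ))
      exact ⟨u, u.2, hu, by simp [h0]⟩
    · have hn : ‖v‖ ≠ 0 := norm_ne_zero_iff.mpr h0
      refine ⟨‖v‖⁻¹ • v, V.smul_mem _ hvV, ?_, ?_⟩
      · rw [norm_smul, norm_inv, norm_norm, inv_mul_cancel₀ hn]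
      · rw [smul_smul, mul_inv_cancel₀ hn, one_smul]
  rw [Metric.mem_thickening_iff]
  refine ⟨c + ‖a‖ • u, ⟨?_, ?_⟩, ?_⟩
  · have : (‖a‖ • u) +ᵥ c ∈ P := AffineSubspace.vadd_mem_of_mem_direction (V.smul_mem _ huV) hcP
    rw [vadd_eq_add, add_comm] at this
    exact this
  · rw [mem_sphere_zero_iff_norm]
    have h3 := horth (‖a‖ • u) (V.smul_mem _ huV)
    rw [norm_smul, norm_norm, hu1, mul_one, h1] at h3
    nlinarith [norm_nonneg (c + ‖a‖ • u)]
  · have hpq : dist p (c + ‖a‖ • u) = |‖v‖ - ‖a‖| := by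
      rw [dist_eq_norm]
      have : p - (c + ‖a‖ • u) = (‖v‖ - ‖a‖) • u := by
        rw [sub_smul, ← hvu, hpv]; abel
      rw [this, norm_smul, hu1, mul_one, Real.norm_eq_abs]
    have h4 : |‖x‖ - ‖p‖| ≤ dist x p := by
      rw [dist_eq_norm]; exact abs_norm_sub_norm_le x p
    rw [hx2] at h4
    have h5 : |1 - ‖p‖| < t ^ 2 := lt_of_le_of_lt h4 hxp
    rw [abs_lt] at h5
    have ht2 : t ^ 2 ≤ t := by nlinarith
    have h6 : |‖v‖ - ‖a‖| < 2 * t := by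
      have hvn := norm_nonneg v
      have han := norm_nonneg a
      have hpn := norm_nonneg p
      have h7 : ‖v‖ ^ 2 - ‖a‖ ^ 2 = ‖p‖ ^ 2 - 1 := by linarith
      have h8 : ‖p‖ ^ 2 - 1 < 3 * t ^ 2 := by nlinarith
      have h9 : -(3 * t ^ 2) < ‖p‖ ^ 2 - 1 := by nlinarith
      rw [abs_lt]
      constructor
      · by_contra! hcon
        nlinarith
      · by_contra! hcon
        nlinarith
    calc dist x (c + ‖a‖ • u) ≤ dist x p + dist p (c + ‖a‖ • u) := dist_triangle _ _ _
      _ < 3 * t := by rw [hpq]; linarith
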